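/- Define a transformation of Borel subsets of ℝ by A* = (0, L¹(A)) if L¹(A) ≤ 1, A* = (L¹(A)/2 − 1/2, L¹(A) + 1/2) if 1 < L¹(A) < ∞, and A* = ℝ if L¹(A) = ∞ (with ∅* = ∅), and let ·* denote the induced transformation of functions acting on level sets. Let u : ℝ → ℝ be defined by u(x) = max(1 − |x|, 0). Then u ∈ W^{1,1}_loc(ℝ), ∫_ℝ |du| < ∞, but the rearranged function u* does not belong to W^{1,1}_loc(ℝ). -/

import Mathlib

open MeasureTheory Set Filter Topology ENNReal

noncomputable section

/-- `Du` is the weak derivative of `u` on `ℝ`. -/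
def HasWeakDeriv (u Du : ℝ → ℝ) : Prop :=
  LocallyIntegrable u volume ∧ LocallyIntegrable Du volume ∧
    ∀ φ : ℝ → ℝ, ContDiff ℝ (⊤ : ℕ∞) φ → HasCompactSupport φ →
      ∫ x, u x * deriv φ x = - ∫ x, Du x * φ x

/-- The (non measure-preserving) set transformation of the example. -/
def starSet (A : Set ℝ) : Set ℝ :=
  if volume A = ⊤ then univ
  else if volume A ≤ 1 then Ioo 0 (volume A).toReal
  else Ioo ((volume A).toReal / 2 - 1 / 2) ((volume A).toReal + 1 / 2)

/-- The function `u(x) = max(1 - |x|, 0)`. -/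
def uex : ℝ → ℝ := fun x => max (1 - |x|) 0

/-- The rearrangement of `uex` induced by `starSet` acting on level sets. -/
def uexStar : ℝ → ℝ := fun y => sSup {t : ℝ | y ∈ starSet {x : ℝ | t < uex x}}

/-- A compactly supported Lipschitz function has its pointwise derivative as an integrable weak
derivative. -/
lemma LipschitzWith.hasWeakDeriv {C : NNReal} {u : ℝ → ℝ} (hu : LipschitzWith C u)
    (hc : HasCompactSupport u) : HasWeakDeriv u (deriv u) ∧ Integrable (deriv u) := by
  have hint : Integrable (deriv u) := by
    rw [← integrableOn_iff_integrable_of_support_subset support_deriv_subset]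
    exact Measure.integrableOn_of_bounded hc.measure_lt_top.ne
      (measurable_deriv u).aestronglyMeasurable
      (Eventually.of_forall fun x => norm_deriv_le_of_lipschitz hu)
  refine ⟨⟨hu.continuous.locallyIntegrable, hint.locallyIntegrable, fun φ hφ hφc => ?_⟩, hint⟩
  obtain ⟨D, hD⟩ := hφ.lipschitzWith_of_hasCompactSupport hφc (by simp)
  have hline (f : ℝ → ℝ) (x : ℝ) : lineDeriv ℝ f x 1 = deriv f x := by
    simp [lineDeriv, deriv_comp_const_add]
  have key := hu.integral_lineDeriv_mul_eq (μ := volume) hD hφc 1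
  simp only [lineDeriv_neg, hline, neg_mul, integral_neg] at key
  rw [key, neg_neg]
  simp only [mul_comm]

lemma lipschitzWith_uex : LipschitzWith 1 uex := by
  refine LipschitzWith.of_dist_le_mul fun x y => ?_
  simp only [uex, Real.dist_eq, NNReal.coe_one, one_mul]
  calc |max (1 - |x|) 0 - max (1 - |y|) 0| ≤ |(1 - |x|) - (1 - |y|)| :=
        abs_max_sub_max_le_abs _ _ _
    _ = |(|y| - |x|)| := by ring_nf
    _ ≤ |y - x| := abs_abs_sub_abs_le _ _
    _ = |x - y| := abs_sub_comm _ _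

lemma hasCompactSupport_uex : HasCompactSupport uex := by
  refine HasCompactSupport.intro (isCompact_Icc (a := -1) (b := 1)) fun x hx => ?_
  simp only [uex]
  refine max_eq_right ?_
  by_contra! h
  exact hx (abs_le.mp (by linarith))

lemma superlevel_uex_of_neg {t : ℝ} (ht : t < 0) : {x | t < uex x} = univ :=
  eq_univ_of_forall fun _ => ht.trans_le (le_max_right _ _)

lemma superlevel_uex_of_nonneg {t : ℝ} (ht : 0 ≤ t) :
    {x | t < uex x} = Ioo (-(1 - t)) (1 - t) := by
  ext x
  simp only [uex, mem_ofPred_eq, lt_max_iff, not_lt.mpr ht, or_false, mem_Ioo, ← abs_lt]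
  constructor <;> intro h <;> linarith

lemma volume_superlevel_uex {t : ℝ} (ht : 0 ≤ t) :
    volume {x | t < uex x} = ENNReal.ofReal (2 - 2 * t) := by
  rw [superlevel_uex_of_nonneg ht, Real.volume_Ioo]
  congr 1
  ring

lemma starSet_superlevel_uex_of_neg {t : ℝ} (ht : t < 0) :
    starSet {x | t < uex x} = univ := by
  simp [starSet, superlevel_uex_of_neg ht]

lemma starSet_superlevel_uex_of_lt_half {t : ℝ} (h0 : 0 ≤ t) (ht : t < 1 / 2) :
    starSet {x | t < uex x} = Ioo (1 / 2 - t) (5 / 2 - 2 * t) := by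
  have h1 : ¬ 2 - 2 * t ≤ 1 := by linarith
  rw [starSet, volume_superlevel_uex h0, if_neg ENNReal.ofReal_ne_top,
    if_neg (by rwa [ENNReal.ofReal_le_one]), ENNReal.toReal_ofReal (by linarith)]
  congr 1 <;> ring

lemma starSet_superlevel_uex_of_half_le {t : ℝ} (ht : 1 / 2 ≤ t) :
    starSet {x | t < uex x} = Ioo 0 (2 - 2 * t) := by
  have h1 : 2 - 2 * t ≤ 1 := by linarith
  rw [starSet, volume_superlevel_uex (by linarith), if_neg ENNReal.ofReal_ne_top,
    if_pos (by rwa [ENNReal.ofReal_le_one]), ENNReal.toReal_ofReal']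
  rcases le_total 0 (2 - 2 * t) with h | h
  · rw [max_eq_left h]
  · rw [max_eq_right h, Ioo_self, Ioo_eq_empty (by linarith)]

lemma uexStar_of_nonpos {y : ℝ} (hy : y ≤ 0) : uexStar y = 0 := by
  have : {t : ℝ | y ∈ starSet {x : ℝ | t < uex x}} = Iio 0 := by
    ext t
    simp only [mem_ofPred_eq, mem_Iio]
    refine ⟨fun h => ?_, fun h => by simp [starSet_superlevel_uex_of_neg h]⟩
    by_contra! h0
    rcases lt_or_ge t (1 / 2) with ht | ht
    · rw [starSet_superlevel_uex_of_lt_half h0 ht] at h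
      linarith [h.1]
    · rw [starSet_superlevel_uex_of_half_le ht] at h
      linarith [h.1]
  rw [uexStar, this, csSup_Iio]

lemma uexStar_of_mem_Ioo {y : ℝ} (hy : y ∈ Ioo (0 : ℝ) 1) : uexStar y = 1 - y / 2 := by
  obtain ⟨hy0, hy1⟩ := hy
  have hmem {t : ℝ} (h1 : 1 / 2 ≤ t) (h2 : t < 1 - y / 2) :
      y ∈ starSet {x : ℝ | t < uex x} := by
    rw [starSet_superlevel_uex_of_half_le h1]
    exact ⟨hy0, by linarith⟩
  refine IsLUB.csSup_eq ⟨fun t ht => ?_, fun b hb => ?_⟩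
    ⟨1 / 2, hmem le_rfl (by linarith)⟩
  · rcases lt_or_ge t (1 / 2) with h | h
    · linarith
    · rw [mem_ofPred_eq, starSet_superlevel_uex_of_half_le h] at ht
      linarith [ht.2]
  · refine le_of_forall_lt_imp_le_of_dense fun c hc => ?_
    exact (le_max_left c (1 / 2)).trans
      (hb (hmem (le_max_right _ _) (max_lt hc (by linarith))))

/-- Integration by parts for `uexStar` sees the jump of height one at the origin. -/
lemma integral_uexStar_mul_deriv {φ : ℝ → ℝ} (hφ : ContDiff ℝ 1 φ)
    (hs : tsupport φ ⊆ Iio 1) :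
    ∫ x, uexStar x * deriv φ x =
      (∫ x, (Ioc (0 : ℝ) 1).indicator (fun _ => 1 / 2) x * φ x) - φ 0 := by
  have h1 {x : ℝ} (hx : 1 ≤ x) : x ∉ tsupport φ := fun h => not_lt.mpr hx (hs h)
  have hL : (fun x => uexStar x * deriv φ x) =
      (Ioc (0 : ℝ) 1).indicator (fun x => (1 - x / 2) * deriv φ x) := by
    ext x
    rcases le_or_gt x 0 with h0 | h0
    · simp [uexStar_of_nonpos h0, not_lt.mpr h0]
    rcases lt_or_ge x 1 with hx | hx
    · rw [indicator_of_mem (show x ∈ Ioc (0 : ℝ) 1 from ⟨h0, hx.le⟩),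
        uexStar_of_mem_Ioo ⟨h0, hx⟩]
    · have : deriv φ x = 0 := deriv_of_notMem_tsupport (h1 hx)
      simp [indicator, this]
  have hR : (fun x => (Ioc (0 : ℝ) 1).indicator (fun _ => (1 / 2 : ℝ)) x * φ x) =
      (Ioc (0 : ℝ) 1).indicator (fun x => 1 / 2 * φ x) := by
    ext x
    simp [indicator]
  have hparts := intervalIntegral.integral_mul_deriv_eq_deriv_mul (a := 0) (b := 1)
    (u := fun x : ℝ => 1 - x / 2) (u' := fun _ => -(1 / 2)) (v := φ) (v' := deriv φ)
    (fun x _ => ((hasDerivAt_id x).div_const 2).const_sub 1)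
    (fun x _ => (hφ.differentiable one_ne_zero x).hasDerivAt)
    intervalIntegrable_const ((hφ.continuous_deriv le_rfl).intervalIntegrable _ _)
  rw [hL, hR, integral_indicator measurableSet_Ioc, integral_indicator measurableSet_Ioc,
    ← intervalIntegral.integral_of_le zero_le_one, ← intervalIntegral.integral_of_le zero_le_one,
    hparts, image_eq_zero_of_notMem_tsupport (h1 le_rfl)]
  simp only [neg_mul, intervalIntegral.integral_neg]
  ring

/-- Evaluation at the origin is not represented by a locally integrable function, even against
test functions supported near the origin. -/
lemma MeasureTheory.LocallyIntegrable.exists_integral_mul_ne {g : ℝ → ℝ} (hg : LocallyIntegrable g volume)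
    {r : ℝ} (hr : 0 < r) :
    ∃ φ : ℝ → ℝ, ContDiff ℝ (⊤ : ℕ∞) φ ∧ HasCompactSupport φ ∧
      tsupport φ ⊆ Metric.closedBall 0 r ∧ ∫ x, g x * φ x ≠ φ 0 := by
  have hpos (n : ℕ) : 0 < r / (n + 2 : ℝ) := by positivity
  let b (n : ℕ) : ContDiffBump (0 : ℝ) :=
    ⟨r / (n + 2 : ℝ) / 2, r / (n + 2 : ℝ), half_pos (hpos n), half_lt_self (hpos n)⟩
  have hle (n : ℕ) : (b n).rOut ≤ r :=
    div_le_self hr.le (by linarith [(n.cast_nonneg : (0 : ℝ) ≤ n)])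
  have hb0 (n : ℕ) : b n 0 = 1 :=
    (b n).one_of_mem_closedBall (Metric.mem_closedBall_self (b n).rIn_pos.le)
  have htend : Tendsto (fun n => (b n).rOut) atTop (𝓝 0) := by
    have : Tendsto (fun n : ℕ => (n : ℝ) + 2) atTop atTop :=
      tendsto_atTop_add_const_right _ _ tendsto_natCast_atTop_atTop
    exact this.const_div_atTop r
  by_contra! hall
  have hint (n : ℕ) : ∫ x, g x * b n x = 1 := by
    rw [← hb0 n]
    refine hall (b n) (b n).contDiff (b n).hasCompactSupport ?_
    rw [(b n).tsupport_eq]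
    exact Metric.closedBall_subset_closedBall (hle n)
  have hlim : Tendsto (fun n => ∫ x, g x * b n x) atTop (𝓝 (∫ _ : ℝ, (0 : ℝ))) := by
    refine tendsto_integral_of_dominated_convergence
      ((Metric.closedBall 0 r).indicator fun x => ‖g x‖)
      (fun n => hg.aestronglyMeasurable.mul (b n).continuous.aestronglyMeasurable)
      (IntegrableOn.integrable_indicator
        (hg.integrableOn_isCompact (isCompact_closedBall 0 r)).norm measurableSet_closedBall)
      (fun n => Eventually.of_forall fun x => ?_) ?_
    · by_cases hx : x ∈ Metric.closedBall (0 : ℝ) r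
      · rw [indicator_of_mem hx, norm_mul, Real.norm_of_nonneg (b n).nonneg]
        exact mul_le_of_le_one_right (norm_nonneg _) (b n).le_one
      · rw [indicator_of_notMem hx, (b n).zero_of_le_dist, mul_zero, norm_zero]
        exact (hle n).trans (not_le.mp hx).le
    · filter_upwards [Measure.ae_ne volume (0 : ℝ)] with x hx
      refine tendsto_const_nhds.congr' ?_
      filter_upwards [htend.eventually_le_const (dist_pos.mpr hx)] with n hn
      rw [(b n).zero_of_le_dist hn, mul_zero]
  simp only [hint, integral_zero] at hlim
  exact one_ne_zero (tendsto_nhds_unique tendsto_const_nhds hlim)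

lemma not_hasWeakDeriv_uexStar (Dv : ℝ → ℝ) : ¬ HasWeakDeriv uexStar Dv := by
  rintro ⟨-, hDv, hweak⟩
  have hI : LocallyIntegrable ((Ioc (0 : ℝ) 1).indicator fun _ => (1 / 2 : ℝ)) volume :=
    (locallyIntegrable_const _).indicator measurableSet_Ioc
  obtain ⟨φ, hφ, hc, hs, hne⟩ :=
    (hDv.add hI).exists_integral_mul_ne (r := 1 / 2) (by norm_num)
  have hs1 : tsupport φ ⊆ Iio 1 := fun x hx => by
    have := (Real.closedBall_eq_Icc ▸ hs hx).2
    rw [mem_Iio]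
    linarith
  have hint {f : ℝ → ℝ} (hf : LocallyIntegrable f volume) : Integrable fun x => f x * φ x :=
    hf.integrable_smul_right_of_hasCompactSupport hφ.continuous hc
  have hparts := integral_uexStar_mul_deriv (hφ.of_le (by simp)) hs1
  rw [hweak φ hφ hc] at hparts
  apply hne
  simp only [Pi.add_apply, add_mul]
  rw [integral_add (hint hDv) (hint hI)]
  linarith

/-- The local coercivity assumption cannot be dropped: `u ∈ W^{1,1}_loc(ℝ)`
and `∫ |du| < ∞`, but `u* ∉ W^{1,1}_loc(ℝ)`. -/
theorem statement11 :
    (∃ Du : ℝ → ℝ, HasWeakDeriv uex Du ∧ ∫⁻ x, ENNReal.ofReal |Du x| < ⊤) ∧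
    ¬ ∃ Dv : ℝ → ℝ, HasWeakDeriv uexStar Dv := by
  obtain ⟨hweak, hint⟩ := lipschitzWith_uex.hasWeakDeriv hasCompactSupport_uex
  exact ⟨⟨deriv uex, hweak, hint.abs.lintegral_lt_top⟩,
    fun ⟨Dv, hDv⟩ => not_hasWeakDeriv_uexStar Dv hDv⟩
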